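/- arXiv:1908.06934 — 7 statements merged into one kernel-verified Lean document; each statement's English description precedes it below -/
import Mathlib

section
/- Let Σ be a symmetric positive definite d×d real matrix partitioned into N×N blocks, μ ∈ ℝ^d, f the Gaussian density with mean μ and covariance Σ, and f_n the Gaussian density of the n-th block (mean μ_n, covariance Σ_{nn}). Then there exists ε > 0 such that for all real t with |t| < ε, ∫_{ℝ^d} f(x) · exp( t · ln( f(x) / ∏_{n=1}^N f_n(x_n) ) ) dx = ( ∏_{n=1}^N det Σ_{nn} / det Σ )^{t/2} · det(I_d − t Γ)^{−1/2}. Equivalently, the cumulant-generating function of the multiinformation density i_d equals t·I(X₁;…;X_N) − (1/2)·ln det(I_d − tΓ), where I(X₁;…;X_N) = (1/2)·ln( ∏_n det Σ_{nn} / det Σ ). -/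
open MeasureTheory Matrix Real

noncomputable section

/-- Index type for a vector partitioned into `N` blocks of sizes `d 0, …, d (N-1)`. -/
abbrev blockIdx {N : ℕ} (d : Fin N → ℕ) : Type := (n : Fin N) × Fin (d n)

/-- The `(m, n)` block of a partitioned matrix. -/
def blockOf {N : ℕ} (d : Fin N → ℕ) (S : Matrix (blockIdx d) (blockIdx d) ℝ)
    (m n : Fin N) : Matrix (Fin (d m)) (Fin (d n)) ℝ :=
  Matrix.of fun i j => S ⟨m, i⟩ ⟨n, j⟩

/-- The block-diagonal matrix `diag (Σ₁₁, …, Σ_NN)` with the same diagonal blocks as `S`. -/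
def blockDiagPart {N : ℕ} (d : Fin N → ℕ) (S : Matrix (blockIdx d) (blockIdx d) ℝ) :
    Matrix (blockIdx d) (blockIdx d) ℝ :=
  Matrix.of fun i j => if i.1 = j.1 then S i j else 0

/-- The multivariate normal density with mean `μ` and covariance matrix `S`. -/
def gaussDensity {ι : Type*} [Fintype ι] [DecidableEq ι]
    (μ : ι → ℝ) (S : Matrix ι ι ℝ) (x : ι → ℝ) : ℝ :=
  (Real.sqrt ((2 * π) ^ (Fintype.card ι) * S.det))⁻¹ *
    Real.exp (-(1 / 2) * ((x - μ) ⬝ᵥ (S⁻¹ *ᵥ (x - μ))))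

open scoped MatrixOrder in
/-- A positive definite matrix has an invertible factor `B` with `A = Bᵀ * B`. -/
theorem Matrix.PosDef.exists_isUnit_transpose_mul_self {ι : Type*} [Fintype ι] [DecidableEq ι]
    {A : Matrix ι ι ℝ} (hA : A.PosDef) : ∃ B : Matrix ι ι ℝ, IsUnit B ∧ A = Bᵀ * B := by
  obtain ⟨B, hB⟩ := CStarAlgebra.nonneg_iff_eq_star_mul_self.mp hA.posSemidef.nonneg
  rw [star_eq_conjTranspose, conjTranspose_eq_transpose_of_trivial] at hB
  refine ⟨B, ?_, hB⟩
  have h := hA.det_pos.ne'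
  rw [hB, det_mul] at h
  exact (isUnit_iff_isUnit_det B).2 (right_ne_zero_of_mul h).isUnit

/-- Positive definiteness is stable under small perturbations along a symmetric direction. -/
theorem Matrix.PosDef.eventually_add_smul {ι : Type*} [Fintype ι] [DecidableEq ι]
    {A H : Matrix ι ι ℝ} (hA : A.PosDef) (hH : H.IsHermitian) :
    ∀ᶠ t : ℝ in nhds 0, (A + t • H).PosDef := by
  obtain ⟨B, hB, rfl⟩ := hA.exists_isUnit_transpose_mul_self
  have hBdet := (isUnit_iff_isUnit_det B).1 hB
  set K : Matrix ι ι ℝ := B⁻¹ᴴ * H * B⁻¹ with hK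
  have hKH : K.IsHermitian := isHermitian_conjTranspose_mul_mul B⁻¹ hH
  have hHK : H = star B * K * B := by
    have h₁ : star B * B⁻¹ᴴ = 1 := by
      rw [star_eq_conjTranspose, ← conjTranspose_mul, nonsing_inv_mul _ hBdet, conjTranspose_one]
    calc H = (star B * B⁻¹ᴴ) * H * (B⁻¹ * B) := by rw [h₁, nonsing_inv_mul _ hBdet]; simp
      _ = star B * K * B := by simp only [hK, Matrix.mul_assoc]
  have hev : ∀ᶠ t : ℝ in nhds 0, ∀ i, 0 < 1 + t * hKH.eigenvalues i := by
    refine Filter.eventually_all.2 fun i => ?_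
    have hc : Continuous fun t : ℝ => 1 + t * hKH.eigenvalues i := by fun_prop
    exact hc.continuousAt.eventually (lt_mem_nhds (by simp))
  filter_upwards [hev] with t ht
  have hsum : Bᵀ * B + t • H = star B * (1 + t • K) * B := by
    rw [hHK, star_eq_conjTranspose, conjTranspose_eq_transpose_of_trivial]
    simp [Matrix.mul_add, Matrix.add_mul]
  rw [hsum, Matrix.IsUnit.posDef_star_left_conjugate_iff hB]
  have hspec : 1 + t • K = (hKH.eigenvectorUnitary : Matrix ι ι ℝ) *
      diagonal (fun i => 1 + t * hKH.eigenvalues i) *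
        star (hKH.eigenvectorUnitary : Matrix ι ι ℝ) := by
    have hdiag : diagonal (fun i => 1 + t * hKH.eigenvalues i) =
        1 + t • diagonal hKH.eigenvalues := by
      rw [← diagonal_one, ← diagonal_smul, diagonal_add]
      rfl
    conv_lhs => rw [hKH.spectral_theorem]
    rw [hdiag]
    simp [Unitary.conjStarAlgAut_apply, Matrix.mul_add, Matrix.add_mul]
  rw [hspec, Matrix.IsUnit.posDef_star_right_conjugate_iff
    (Unitary.isUnit_coe (U := hKH.eigenvectorUnitary))]
  exact PosDef.diagonal ht

/-- The multivariate Gaussian integral. -/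
theorem integral_exp_neg_half_quadraticForm {ι : Type*} [Fintype ι] [DecidableEq ι]
    {A : Matrix ι ι ℝ} (hA : A.PosDef) :
    ∫ x : ι → ℝ, Real.exp (-(1 / 2) * (x ⬝ᵥ (A *ᵥ x))) =
      √((2 * π) ^ Fintype.card ι / A.det) := by
  obtain ⟨B, hB, rfl⟩ := hA.exists_isUnit_transpose_mul_self
  have hBdet : B.det ≠ 0 := ((isUnit_iff_isUnit_det B).1 hB).ne_zero
  have hstd : ∫ y : ι → ℝ, Real.exp (-(1 / 2) * (y ⬝ᵥ y)) = √(2 * π) ^ Fintype.card ι := by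
    have hprod (y : ι → ℝ) : Real.exp (-(1 / 2) * (y ⬝ᵥ y)) =
        ∏ i, Real.exp (-(1 / 2) * y i ^ 2) := by
      simp [← Real.exp_sum, dotProduct, Finset.mul_sum, pow_two]
    simp_rw [hprod]
    rw [integral_fintype_prod_volume_eq_pow (fun y : ℝ => Real.exp (-(1 / 2) * y ^ 2)),
      integral_gaussian]
    congr 2
    ring
  have hquad (x : ι → ℝ) : x ⬝ᵥ ((Bᵀ * B) *ᵥ x) = toLin' B x ⬝ᵥ toLin' B x := by
    rw [toLin'_apply, ← mulVec_mulVec, dotProduct_mulVec, vecMul_transpose]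
  simp_rw [hquad]
  have hmeas : AEMeasurable (toLin' B) (volume : Measure (ι → ℝ)) :=
    (LinearMap.continuous_of_finiteDimensional _).aemeasurable
  have hcont : Continuous fun y : ι → ℝ => Real.exp (-(1 / 2) * (y ⬝ᵥ y)) := by
    unfold dotProduct
    fun_prop
  rw [← integral_map (f := fun y : ι → ℝ => Real.exp (-(1 / 2) * (y ⬝ᵥ y))) hmeas
      hcont.aestronglyMeasurable, Real.map_matrix_volume_pi_eq_smul_volume_pi hBdet,
    integral_smul_measure, hstd, ENNReal.toReal_ofReal (abs_nonneg _), det_mul, det_transpose,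
    Real.sqrt_div (by positivity), Real.sqrt_mul_self_eq_abs, abs_inv, smul_eq_mul,
    Real.sqrt_eq_rpow, Real.sqrt_eq_rpow, ← Real.rpow_natCast, ← Real.rpow_natCast,
    ← Real.rpow_mul (by positivity), ← Real.rpow_mul (by positivity), mul_comm (1 / 2 : ℝ)]
  ring

section BlockDiagonal

variable {N : ℕ} (d : Fin N → ℕ) {S : Matrix (blockIdx d) (blockIdx d) ℝ}

theorem blockDiagPart_eq_blockDiagonal' (S : Matrix (blockIdx d) (blockIdx d) ℝ) :
    blockDiagPart d S = blockDiagonal' fun n => blockOf d S n n := by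
  ext ⟨m, i⟩ ⟨n, j⟩
  by_cases h : m = n
  · subst h
    simp [blockDiagPart, blockOf]
  · simp [blockDiagPart, blockDiagonal'_apply_ne, h]

theorem posDef_blockOf (hS : S.PosDef) (n : Fin N) : (blockOf d S n n).PosDef :=
  hS.submatrix (e := fun i : Fin (d n) => (⟨n, i⟩ : blockIdx d)) fun _ _ h => by simpa using h

theorem inv_blockDiagPart (hS : S.PosDef) :
    (blockDiagPart d S)⁻¹ = blockDiagonal' fun n => (blockOf d S n n)⁻¹ := by
  apply inv_eq_right_inv
  rw [blockDiagPart_eq_blockDiagonal', ← blockDiagonal'_mul, ← blockDiagonal'_one]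
  congr 1
  funext n
  exact mul_nonsing_inv _ ((isUnit_iff_isUnit_det _).1 (posDef_blockOf d hS n).isUnit)

theorem dotProduct_blockDiagonal'_mulVec (M : ∀ n, Matrix (Fin (d n)) (Fin (d n)) ℝ)
    (z : blockIdx d → ℝ) :
    z ⬝ᵥ (blockDiagonal' M *ᵥ z) =
      ∑ n, (fun i => z ⟨n, i⟩) ⬝ᵥ (M n *ᵥ fun i => z ⟨n, i⟩) := by
  simp only [dotProduct, mulVec, Fintype.sum_sigma]
  refine Finset.sum_congr rfl fun n _ => Finset.sum_congr rfl fun i _ => ?_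
  congr 1
  rw [Finset.sum_eq_single n]
  · simp
  · intro m _ hm
    exact Finset.sum_eq_zero fun j _ => by rw [blockDiagonal'_apply_ne M _ _ hm.symm, zero_mul]
  · simp

theorem isHermitian_inv_blockDiagPart (hS : S.PosDef) : (blockDiagPart d S)⁻¹.IsHermitian := by
  rw [inv_blockDiagPart d hS, IsHermitian, blockDiagonal'_conjTranspose]
  congr 1
  funext n
  exact (posDef_blockOf d hS n).inv.isHermitian

end BlockDiagonal

section Density

variable {ι : Type*} [Fintype ι] [DecidableEq ι] {S : Matrix ι ι ℝ}

theorem gaussDensity_pos (hS : S.PosDef) (μ x : ι → ℝ) : 0 < gaussDensity μ S x := by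
  have := hS.det_pos
  unfold gaussDensity
  positivity

theorem log_gaussDensity (hS : S.PosDef) (μ x : ι → ℝ) :
    Real.log (gaussDensity μ S x) =
      -(1 / 2) * (Fintype.card ι * Real.log (2 * π) + Real.log S.det +
        (x - μ) ⬝ᵥ (S⁻¹ *ᵥ (x - μ))) := by
  have := hS.det_pos
  rw [gaussDensity, Real.log_mul (by positivity) (by positivity), Real.log_exp, Real.log_inv,
    Real.log_sqrt (by positivity), Real.log_mul (by positivity) (by positivity), Real.log_pow]
  ring

end Density

/-- The multiinformation density of a Gaussian vector as a quadratic function. -/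
theorem log_gaussDensity_div_prod {N : ℕ} (d : Fin N → ℕ)
    {S : Matrix (blockIdx d) (blockIdx d) ℝ} (hS : S.PosDef) (μ x : blockIdx d → ℝ) :
    Real.log (gaussDensity μ S x / ∏ n : Fin N,
        gaussDensity (fun i => μ ⟨n, i⟩) (blockOf d S n n) (fun i => x ⟨n, i⟩)) =
      1 / 2 * Real.log ((∏ n : Fin N, (blockOf d S n n).det) / S.det) -
        1 / 2 * ((x - μ) ⬝ᵥ ((S⁻¹ - (blockDiagPart d S)⁻¹) *ᵥ (x - μ))) := by
  have hdet n : (blockOf d S n n).det ≠ 0 := (posDef_blockOf d hS n).det_pos.ne'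
  have hpos n := gaussDensity_pos (posDef_blockOf d hS n) (fun i => μ ⟨n, i⟩) (fun i => x ⟨n, i⟩)
  rw [Real.log_div (gaussDensity_pos hS μ x).ne' (Finset.prod_pos fun n _ => hpos n).ne',
    Real.log_prod fun n _ => (hpos n).ne', log_gaussDensity hS,
    Real.log_div (Finset.prod_ne_zero_iff.2 fun n _ => hdet n) hS.det_pos.ne',
    Real.log_prod fun n _ => hdet n, sub_mulVec, dotProduct_sub, inv_blockDiagPart d hS,
    dotProduct_blockDiagonal'_mulVec]
  simp only [fun n => log_gaussDensity (posDef_blockOf d hS n), ← Finset.mul_sum,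
    Finset.sum_add_distrib, ← Finset.sum_mul, Fintype.card_sigma, Fintype.card_fin, Nat.cast_sum]
  have hsub n : ((fun i => x ⟨n, i⟩) - fun i => μ ⟨n, i⟩ : Fin (d n) → ℝ) =
    fun i => (x - μ) ⟨n, i⟩ := rfl
  simp only [hsub]
  ring

/-- The moment-generating function of the multiinformation density `i_d` of a
multivariate normal vector equals
`(∏ₙ det Σₙₙ / det Σ)^(t/2) · det(I − tΓ)^(−1/2)` near `t = 0`;
equivalently, the cumulant-generating function of `i_d` is
`t · I(X₁;…;X_N) − ½ ln det(I − tΓ)`. -/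
theorem cgf_multiinformation_density {N : ℕ} (hN : 2 ≤ N) (d : Fin N → ℕ)
    (S : Matrix (blockIdx d) (blockIdx d) ℝ) (hS : S.PosDef) (μ : blockIdx d → ℝ) :
    ∃ ε > 0, ∀ t : ℝ, |t| < ε →
      (∫ x : blockIdx d → ℝ,
          gaussDensity μ S x *
            Real.exp (t * Real.log (gaussDensity μ S x /
              ∏ n : Fin N,
                gaussDensity (fun i => μ ⟨n, i⟩) (blockOf d S n n) (fun i => x ⟨n, i⟩)))) =
        ((∏ n : Fin N, (blockOf d S n n).det) / S.det) ^ (t / 2) *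
          ((1 - t • (S * (blockDiagPart d S)⁻¹ - 1)).det) ^ (-(1 : ℝ) / 2) := by
  have hH : (S⁻¹ - (blockDiagPart d S)⁻¹).IsHermitian :=
    hS.inv.isHermitian.sub (isHermitian_inv_blockDiagPart d hS)
  obtain ⟨ε, hε, hball⟩ := Metric.eventually_nhds_iff.1 (hS.inv.eventually_add_smul hH)
  refine ⟨ε, hε, fun t ht => ?_⟩
  have hA := hball (y := t) (by simpa using ht)
  set A := S⁻¹ + t • (S⁻¹ - (blockDiagPart d S)⁻¹) with hA_def
  set R := (∏ n : Fin N, (blockOf d S n n).det) / S.det with hR_def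
  have hSdet := hS.det_pos
  have hR : 0 < R := div_pos (Finset.prod_pos fun n _ => (posDef_blockOf d hS n).det_pos) hSdet
  have hΓ : 1 - t • (S * (blockDiagPart d S)⁻¹ - 1) = S * A := by
    rw [hA_def, Matrix.mul_add, Matrix.mul_smul, Matrix.mul_sub,
      mul_nonsing_inv _ hSdet.ne'.isUnit, ← neg_sub (S * _), smul_neg, sub_eq_add_neg]
  have hintegrand (x : blockIdx d → ℝ) :
      gaussDensity μ S x * Real.exp (t * Real.log (gaussDensity μ S x / ∏ n : Fin N,
        gaussDensity (fun i => μ ⟨n, i⟩) (blockOf d S n n) (fun i => x ⟨n, i⟩))) =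
      (√((2 * π) ^ Fintype.card (blockIdx d) * S.det))⁻¹ * R ^ (t / 2) *
        Real.exp (-(1 / 2) * ((x - μ) ⬝ᵥ (A *ᵥ (x - μ)))) := by
    rw [log_gaussDensity_div_prod d hS, gaussDensity, Real.rpow_def_of_pos hR, mul_assoc,
      mul_assoc, ← Real.exp_add, ← Real.exp_add, hA_def, add_mulVec, dotProduct_add, smul_mulVec,
      dotProduct_smul, smul_eq_mul]
    congr 2
    ring
  simp_rw [hintegrand]
  rw [integral_const_mul,
    integral_sub_right_eq_self (fun z : blockIdx d → ℝ => Real.exp (-(1 / 2) * (z ⬝ᵥ (A *ᵥ z)))) μ,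
    integral_exp_neg_half_quadraticForm hA, hΓ, det_mul]
  have hAdet := hA.det_pos
  have hsqrt : (√((2 * π) ^ Fintype.card (blockIdx d) * S.det))⁻¹ *
      √((2 * π) ^ Fintype.card (blockIdx d) / A.det) = (S.det * A.det) ^ (-(1 : ℝ) / 2) := by
    rw [neg_div, Real.rpow_neg (by positivity), ← Real.sqrt_eq_rpow, ← Real.sqrt_inv,
      ← Real.sqrt_inv, ← Real.sqrt_mul (by positivity)]
    congr 1
    field_simp
  rw [← hsqrt]
  ring
end
end

section
/- Let Σ be a symmetric positive definite d×d real matrix partitioned into 2×2 blocks where the first block is 1-dimensional (d₁ = 1, Σ₁₁ = σ₁² > 0), and let Γ = Σ·D⁻¹ − I_d. Then for every real t, det(I_d − t Γ) = 1 − t²·R̄², where R̄² = Σ₁₂ Σ₂₂⁻¹ Σ₁₂ᵀ / σ₁² is the squared multiple correlation coefficient of the first component on the remaining components. -/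
open Matrix

noncomputable section

/-- Schur complement formula for `I - tΓ` when `Γ = M D⁻¹ - I` and `D` is the block-diagonal part
of the block matrix `M = [A, B; C, E]`. -/
theorem det_one_sub_smul_fromBlocks_mul_inv_sub_one {n m R : Type*} [Fintype n] [DecidableEq n]
    [Fintype m] [DecidableEq m] [CommRing R] (A : Matrix n n R) (B : Matrix n m R)
    (C : Matrix m n R) (E : Matrix m m R) (hA : IsUnit A) (hE : IsUnit E) (t : R) :
    (1 - t • (fromBlocks A B C E * (fromBlocks A 0 0 E)⁻¹ - 1)).det =
      (1 - t ^ 2 • (B * E⁻¹ * C * A⁻¹)).det := by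
  have hblocks : 1 - t • (fromBlocks A B C E * (fromBlocks A 0 0 E)⁻¹ - 1) =
      fromBlocks 1 (-(t • (B * E⁻¹))) (-(t • (C * A⁻¹))) 1 := by
    rw [inv_fromBlocks_zero₂₁_of_isUnit_iff _ _ _ (iff_of_true hA hE), fromBlocks_multiply,
      ← fromBlocks_one, sub_eq_add_neg (fromBlocks _ _ _ _) (fromBlocks 1 0 0 1),
      fromBlocks_neg, fromBlocks_add, fromBlocks_smul, sub_eq_add_neg, fromBlocks_neg,
      fromBlocks_add]
    simp [mul_nonsing_inv _ ((isUnit_iff_isUnit_det _).1 hA),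
      mul_nonsing_inv _ ((isUnit_iff_isUnit_det _).1 hE)]
  rw [hblocks, det_fromBlocks_one₂₂]
  simp [smul_smul, pow_two, Matrix.mul_assoc]

/-- For a symmetric positive definite matrix `Σ` partitioned into a first block
of size 1 and a second block of size `d − 1`, with `D = diag(Σ₁₁, Σ₂₂)` and
`Γ = Σ·D⁻¹ − I`, we have `det(I − tΓ) = 1 − t²·R̄²` for all real `t`, where
`R̄² = Σ₁₂ Σ₂₂⁻¹ Σ₁₂ᵀ / σ₁²` is the squared multiple correlation coefficient. -/
theorem det_one_sub_smul_gamma_multiple_correlation {m : ℕ}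
    (S : Matrix (Fin 1 ⊕ Fin m) (Fin 1 ⊕ Fin m) ℝ) (hS : S.PosDef) :
    ∀ t : ℝ,
      (1 - t • (S * (Matrix.fromBlocks S.toBlocks₁₁ 0 0 S.toBlocks₂₂)⁻¹ - 1)).det =
        1 - t ^ 2 *
          ((S.toBlocks₁₂ * S.toBlocks₂₂⁻¹ * S.toBlocks₁₂ᵀ) 0 0 /
            S (Sum.inl 0) (Sum.inl 0)) := by
  intro t
  have hA : S.toBlocks₁₁.PosDef := hS.submatrix Sum.inl_injective
  have hE : S.toBlocks₂₂.PosDef := hS.submatrix Sum.inr_injective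
  have hC : S.toBlocks₂₁ = S.toBlocks₁₂ᵀ := by
    ext i j
    simpa [toBlocks₂₁, toBlocks₁₂] using (hS.isHermitian.apply (Sum.inr i) (Sum.inl j)).symm
  have hdet := det_one_sub_smul_fromBlocks_mul_inv_sub_one S.toBlocks₁₁ S.toBlocks₁₂
    S.toBlocks₂₁ S.toBlocks₂₂ hA.isUnit hE.isUnit t
  rw [fromBlocks_toBlocks] at hdet
  rw [hdet, hC, det_fin_one, Matrix.sub_apply, one_apply_eq, Matrix.smul_apply,
    mul_apply (N := S.toBlocks₁₁⁻¹), Fin.sum_univ_one, inv_subsingleton S.toBlocks₁₁,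
    diagonal_apply_eq, Ring.inverse_eq_inv', smul_eq_mul, div_eq_mul_inv, toBlocks₁₁, of_apply]
end
end

section
/- Let Σ be a symmetric positive definite 2×2 real matrix with diagonal entries σ₁², σ₂² and correlation coefficient ρ = Σ₁₂/(σ₁σ₂), and let Γ = Σ·D⁻¹ − I₂ where D = diag(σ₁², σ₂²). Then for every real t, det(I₂ − t Γ) = 1 − t²ρ². Consequently the cumulants of the information density of a bivariate normal vector are 0 for odd order l ≥ 3 and κ_l = (l−1)!·|ρ|^l for even order l. -/
open Matrix Real

noncomputable section

/-- The derivatives at `0` of `t ↦ log (1 + a t)`. -/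
theorem iteratedDeriv_succ_log_mul_add_one_zero (a : ℝ) (n : ℕ) :
    iteratedDeriv (n + 1) (fun t : ℝ => Real.log (a * t + 1)) 0 =
      (-1) ^ n * (n.factorial : ℝ) * a ^ (n + 1) := by
  have hderiv : deriv (fun t : ℝ => Real.log (a * t + 1)) =ᶠ[nhds 0]
      fun t => a * (a * t + 1)⁻¹ := by
    have hne : ∀ᶠ t : ℝ in nhds 0, a * t + 1 ≠ 0 :=
      ContinuousAt.eventually_ne (by fun_prop) (by simp)
    filter_upwards [hne] with t ht
    have hlin : HasDerivAt (fun t : ℝ => a * t + 1) a t := by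
      simpa using ((hasDerivAt_id t).const_mul a).add_const 1
    rw [(hlin.log ht).deriv, div_eq_mul_inv]
  rw [iteratedDeriv_succ', hderiv.iteratedDeriv_eq, iteratedDeriv_const_mul_field,
    iteratedDeriv_eq_iterate, iter_deriv_inv_linear]
  simp only [mul_zero, zero_add, _root_.one_zpow, mul_one]
  ring

/-- The derivatives at `0` of `t ↦ -½ log (1 - t² r²)`. -/
theorem iteratedDeriv_succ_neg_half_log_one_sub_sq_zero (r : ℝ) (n : ℕ) :
    iteratedDeriv (n + 1) (fun t : ℝ => -(1 / 2) * Real.log (1 - t ^ 2 * r ^ 2)) 0 =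
      (n.factorial : ℝ) * ((r ^ (n + 1) + (-r) ^ (n + 1)) / 2) := by
  have hsplit : (fun t : ℝ => Real.log (1 - t ^ 2 * r ^ 2)) =ᶠ[nhds 0]
      fun t => Real.log (r * t + 1) + Real.log (-r * t + 1) := by
    have hne : ∀ a : ℝ, ∀ᶠ t : ℝ in nhds 0, a * t + 1 ≠ 0 := fun a =>
      ContinuousAt.eventually_ne (by fun_prop) (by simp)
    filter_upwards [hne r, hne (-r)] with t ht ht'
    rw [← Real.log_mul ht ht']
    ring_nf
  have hsmooth : ∀ a : ℝ,
      ContDiffAt ℝ (n + 1 : ℕ) (fun t : ℝ => Real.log (a * t + 1)) 0 := fun a =>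
    ContDiffAt.log (by fun_prop) (by simp)
  rw [iteratedDeriv_const_mul_field, hsplit.iteratedDeriv_eq,
    iteratedDeriv_fun_add (hsmooth r) (hsmooth (-r)),
    iteratedDeriv_succ_log_mul_add_one_zero, iteratedDeriv_succ_log_mul_add_one_zero]
  rcases Nat.even_or_odd n with hn | hn
  · rw [hn.neg_one_pow, hn.add_one.neg_pow]
    ring
  · rw [hn.neg_one_pow, hn.add_one.neg_pow]
    ring

/-- For a positive definite `2 × 2` matrix `S` with diagonal part `D`, the determinant of
`1 - t (S D⁻¹ - 1)` in terms of the entries of `S`. -/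
theorem det_one_sub_smul_mul_inv_diagonal_sub_one {S : Matrix (Fin 2) (Fin 2) ℝ}
    (hS : S.PosDef) (t : ℝ) :
    (1 - t • (S * (Matrix.diagonal fun i => S i i)⁻¹ - 1)).det =
      1 - t ^ 2 * (S 0 1 ^ 2 / (S 0 0 * S 1 1)) := by
  have hdiag : ∀ i, S i i ≠ 0 := fun i => hS.diag_pos.ne'
  have hinv : (Matrix.diagonal fun i => S i i)⁻¹ = Matrix.diagonal fun i => (S i i)⁻¹ := by
    apply Matrix.inv_eq_right_inv
    simp [Matrix.diagonal_mul_diagonal, hdiag]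
  have hsymm : S 1 0 = S 0 1 := by simpa using hS.isHermitian.apply 0 1
  rw [hinv, Matrix.det_fin_two]
  simp [hsymm, hdiag]
  field_simp

/-- For a symmetric positive definite 2×2 matrix `Σ` with correlation
coefficient `ρ = Σ₁₂/(σ₁σ₂)`, `D = diag(σ₁², σ₂²)` and `Γ = Σ·D⁻¹ − I₂`, we
have `det(I₂ − tΓ) = 1 − t²ρ²` for all `t`; consequently, the cumulants of the
information density of a bivariate normal vector (the iterated derivatives at
`0` of `t ↦ −½ ln det(I₂ − tΓ)`) vanish for odd order `l ≥ 3` and equal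
`(l−1)!·|ρ|ˡ` for even order `l ≥ 2`. -/
theorem bivariate_info_density_cumulants (S : Matrix (Fin 2) (Fin 2) ℝ)
    (hS : S.PosDef) (ρ : ℝ)
    (hρ : ρ = S 0 1 / (Real.sqrt (S 0 0) * Real.sqrt (S 1 1))) :
    (∀ t : ℝ,
      (1 - t • (S * (Matrix.diagonal fun i => S i i)⁻¹ - 1)).det = 1 - t ^ 2 * ρ ^ 2) ∧
    (∀ l : ℕ, Odd l → 3 ≤ l →
      iteratedDeriv l
          (fun t : ℝ => -(1 / 2) *
            Real.log ((1 - t • (S * (Matrix.diagonal fun i => S i i)⁻¹ - 1)).det)) 0 = 0) ∧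
    (∀ l : ℕ, Even l → 2 ≤ l →
      iteratedDeriv l
          (fun t : ℝ => -(1 / 2) *
            Real.log ((1 - t • (S * (Matrix.diagonal fun i => S i i)⁻¹ - 1)).det)) 0 =
        ((l - 1).factorial : ℝ) * |ρ| ^ l) := by
  have hdet : ∀ t : ℝ,
      (1 - t • (S * (Matrix.diagonal fun i => S i i)⁻¹ - 1)).det = 1 - t ^ 2 * ρ ^ 2 := by
    intro t
    rw [det_one_sub_smul_mul_inv_diagonal_sub_one hS, hρ, div_pow, mul_pow,
      Real.sq_sqrt hS.diag_pos.le, Real.sq_sqrt hS.diag_pos.le]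
  refine ⟨hdet, fun l hl hl3 => ?_, fun l hl hl2 => ?_⟩
  · obtain ⟨n, rfl⟩ : ∃ n, l = n + 1 := ⟨l - 1, by omega⟩
    simp only [hdet]
    rw [iteratedDeriv_succ_neg_half_log_one_sub_sq_zero, hl.neg_pow]
    ring
  · obtain ⟨n, rfl⟩ : ∃ n, l = n + 1 := ⟨l - 1, by omega⟩
    simp only [hdet]
    rw [iteratedDeriv_succ_neg_half_log_one_sub_sq_zero, hl.neg_pow, hl.pow_abs,
      Nat.add_sub_cancel]
    ring
end
end

section
/- Let Σ be a symmetric positive definite d×d real matrix partitioned into N×N blocks, Δ the diagonal matrix with Δ_{kk} = √(Σ_{kk}), and R = Δ⁻¹ Σ Δ⁻¹ the associated correlation matrix. Let Γ_Σ = Σ·D_Σ⁻¹ − I_d and Γ_R = R·D_R⁻¹ − I_d, where D_Σ and D_R are the block-diagonal parts of Σ and R respectively. Then Γ_Σ = Δ · Γ_R · Δ⁻¹, and consequently det(I_d − t Γ_Σ) = det(I_d − t Γ_R) for all real t. (Thus the cumulant-generating function of the multiinformation density does not depend on the variance coefficients of Σ.) -/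
open MeasureTheory Matrix Real

noncomputable section

/-- Taking the block-diagonal part commutes with two-sided scaling by diagonal matrices. -/
theorem blockDiagPart_diagonal_mul_mul_diagonal {N : ℕ} (d : Fin N → ℕ)
    (v w : blockIdx d → ℝ) (S : Matrix (blockIdx d) (blockIdx d) ℝ) :
    blockDiagPart d (diagonal v * S * diagonal w) =
      diagonal v * blockDiagPart d S * diagonal w := by
  ext i j
  simp only [blockDiagPart, of_apply, mul_diagonal, diagonal_mul]
  split_ifs <;> simp

/-- Let `Δ` be the diagonal matrix with entries `√(Σₖₖ)` and `R = Δ⁻¹ Σ Δ⁻¹`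
the correlation matrix of `Σ`. Then `Γ_Σ = Δ · Γ_R · Δ⁻¹`, where
`Γ_M = M·D_M⁻¹ − I`, and consequently `det(I − tΓ_Σ) = det(I − tΓ_R)` for all
real `t`: the cumulant-generating function of the multiinformation density does
not depend on the variances. -/
theorem gamma_independent_of_variances {N : ℕ} (hN : 2 ≤ N) (d : Fin N → ℕ)
    (S : Matrix (blockIdx d) (blockIdx d) ℝ) (hS : S.PosDef)
    (Δ : Matrix (blockIdx d) (blockIdx d) ℝ)
    (hΔ : Δ = Matrix.diagonal fun k => Real.sqrt (S k k))
    (R : Matrix (blockIdx d) (blockIdx d) ℝ) (hR : R = Δ⁻¹ * S * Δ⁻¹) :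
    S * (blockDiagPart d S)⁻¹ - 1 =
      Δ * (R * (blockDiagPart d R)⁻¹ - 1) * Δ⁻¹ ∧
    ∀ t : ℝ,
      (1 - t • (S * (blockDiagPart d S)⁻¹ - 1)).det =
        (1 - t • (R * (blockDiagPart d R)⁻¹ - 1)).det := by
  have hdet : IsUnit Δ.det := by
    rw [hΔ, det_diagonal, isUnit_iff_ne_zero]
    exact Finset.prod_ne_zero_iff.mpr fun k _ => (Real.sqrt_pos.mpr hS.diag_pos).ne'
  have hD : blockDiagPart d R = Δ⁻¹ * blockDiagPart d S * Δ⁻¹ := by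
    rw [hR, hΔ, inv_diagonal, blockDiagPart_diagonal_mul_mul_diagonal]
  have hconj : S * (blockDiagPart d S)⁻¹ = Δ * (R * (blockDiagPart d R)⁻¹) * Δ⁻¹ := by
    rw [hD, hR, Matrix.mul_inv_rev, Matrix.mul_inv_rev, nonsing_inv_nonsing_inv _ hdet]
    simp only [Matrix.mul_assoc, mul_nonsing_inv_cancel_left _ _ hdet,
      nonsing_inv_mul_cancel_left _ _ hdet, mul_nonsing_inv _ hdet, Matrix.mul_one]
  have hΓ : S * (blockDiagPart d S)⁻¹ - 1 =
      Δ * (R * (blockDiagPart d R)⁻¹ - 1) * Δ⁻¹ := by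
    rw [hconj, Matrix.mul_sub, Matrix.sub_mul, Matrix.mul_one, mul_nonsing_inv _ hdet]
  refine ⟨hΓ, fun t => ?_⟩
  rw [hΓ]
  generalize R * (blockDiagPart d R)⁻¹ - 1 = Γ
  rw [← det_conj ((isUnit_iff_isUnit_det Δ).mpr hdet) (1 - t • Γ), Matrix.mul_sub,
    Matrix.sub_mul, Matrix.mul_one, mul_nonsing_inv _ hdet, Matrix.mul_smul, Matrix.smul_mul]
end
end

section
/- Let Σ be a symmetric positive definite d×d real matrix partitioned into N×N blocks. Then ∏_{n=1}^N det Σ_{nn} ≥ det Σ, with equality if and only if all off-diagonal blocks vanish (Σ_{mn} = 0 for all m ≠ n). Equivalently, the multiinformation I = (1/2)·ln( ∏_n det Σ_{nn} / det Σ ) is nonnegative and vanishes if and only if Σ is block diagonal. -/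
open MeasureTheory Matrix Real

noncomputable section

namespace Matrix

section TraceDet

variable {n : Type*} [Fintype n] [DecidableEq n]

/-- A real positive definite matrix whose trace is its size has determinant at most one,
with equality only for the identity matrix. -/
theorem PosDef.det_le_one_of_trace_eq_card {A : Matrix n n ℝ} (hA : A.PosDef)
    (htr : A.trace = Fintype.card n) : A.det ≤ 1 ∧ (A.det = 1 → A = 1) := by
  have hpos := hA.eigenvalues_pos
  have hdet : A.det = ∏ i, hA.isHermitian.eigenvalues i := by
    simpa using hA.isHermitian.det_eq_prod_eigenvalues
  have hsum : ∑ i, (hA.isHermitian.eigenvalues i - 1) = 0 := by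
    have h : A.trace = ∑ i, hA.isHermitian.eigenvalues i := by
      simpa using hA.isHermitian.trace_eq_sum_eigenvalues
    simp [Finset.sum_sub_distrib, ← h, htr]
  have hlog : Real.log A.det = ∑ i, Real.log (hA.isHermitian.eigenvalues i) := by
    rw [hdet, Real.log_prod fun i _ => (hpos i).ne']
  have hle : ∀ i ∈ Finset.univ, Real.log (hA.isHermitian.eigenvalues i) ≤
      hA.isHermitian.eigenvalues i - 1 := fun i _ => Real.log_le_sub_one_of_pos (hpos i)
  refine ⟨?_, fun h => ?_⟩
  · rw [← Real.log_nonpos_iff hA.det_pos.le, hlog, ← hsum]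
    exact Finset.sum_le_sum hle
  · rw [h, Real.log_one, ← hsum] at hlog
    have heq := (Finset.sum_eq_sum_iff_of_le hle).1 hlog.symm
    have hone : hA.isHermitian.eigenvalues = 1 := by
      funext i
      by_contra hi
      exact (Real.log_lt_sub_one_of_pos (hpos i) hi).ne (heq i (Finset.mem_univ i))
    rw [hA.isHermitian.spectral_theorem, hone]
    simp

open scoped MatrixOrder in
/-- If `D⁻¹ * S` has trace equal to its size, then `det S ≤ det D`, with equality only
for `S = D`. -/
theorem PosDef.det_le_det_of_trace_inv_mul {S D : Matrix n n ℝ} (hS : S.PosDef) (hD : D.PosDef)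
    (htr : (D⁻¹ * S).trace = Fintype.card n) : S.det ≤ D.det ∧ (S.det = D.det → S = D) := by
  obtain ⟨B, rfl⟩ := CStarAlgebra.nonneg_iff_eq_star_mul_self.1 hS.posSemidef.nonneg
  rw [star_eq_conjTranspose] at *
  have hBdet : IsUnit B.det := by
    have := hS.det_pos.ne'
    rw [det_mul] at this
    exact (right_ne_zero_of_mul this).isUnit
  have hB : IsUnit B := (isUnit_iff_isUnit_det B).2 hBdet
  have hA : (B * D⁻¹ * Bᴴ).PosDef :=
    hD.inv.mul_mul_conjTranspose_same (vecMul_injective_of_isUnit hB)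
  have hAtr : (B * D⁻¹ * Bᴴ).trace = Fintype.card n := by
    rw [← htr, trace_mul_cycle, trace_mul_comm]
  have hAdet : (B * D⁻¹ * Bᴴ).det = (Bᴴ * B).det / D.det := by
    simp only [det_mul, det_nonsing_inv, Ring.inverse_eq_inv']
    ring
  obtain ⟨hle, heq⟩ := hA.det_le_one_of_trace_eq_card hAtr
  rw [hAdet] at hle heq
  refine ⟨(div_le_one hD.det_pos).1 hle, fun h => ?_⟩
  have hone := heq ((div_eq_one_iff_eq hD.det_pos.ne').2 h)
  have hinv : D⁻¹ * (Bᴴ * B) = 1 := by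
    rw [mul_assoc] at hone
    simpa [mul_assoc] using mul_eq_one_comm.1 hone
  calc Bᴴ * B = D * (D⁻¹ * (Bᴴ * B)) :=
        (mul_nonsing_inv_cancel_left _ _ hD.det_pos.ne'.isUnit).symm
    _ = D := by rw [hinv, mul_one]

end TraceDet

section BlockDiagonal

variable {o : Type*} [Fintype o] [DecidableEq o] {m : o → Type*} [∀ i, Fintype (m i)]

theorem trace_blockDiagonal'_mul (C : ∀ i, Matrix (m i) (m i) ℝ)
    (S : Matrix (Σ i, m i) (Σ i, m i) ℝ) :
    (blockDiagonal' C * S).trace = ∑ i, (C i * S.submatrix (Sigma.mk i) (Sigma.mk i)).trace := by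
  simp only [trace, diag_apply, mul_apply, Fintype.sum_sigma, submatrix_apply]
  refine Finset.sum_congr rfl fun i _ => Finset.sum_congr rfl fun j _ => ?_
  rw [Finset.sum_eq_single i]
  · simp only [blockDiagonal'_apply_eq]
  · intro k _ hk
    exact Finset.sum_eq_zero fun l _ => by rw [blockDiagonal'_apply_ne _ _ _ hk.symm, zero_mul]
  · simp

variable [∀ i, DecidableEq (m i)]

theorem det_blockDiagonal' (M : ∀ i, Matrix (m i) (m i) ℝ) :
    (blockDiagonal' M).det = ∏ i, (M i).det := by
  let _ : LinearOrder o := LinearOrder.lift' (Fintype.equivFin o) (Fintype.equivFin o).injective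
  rw [(blockTriangular_blockDiagonal' M).det_fintype]
  refine Finset.prod_congr rfl fun i _ => ?_
  rw [← det_submatrix_equiv_self (Equiv.sigmaSubtype i).symm]
  congr 1
  ext j k
  exact blockDiagonal'_apply_eq M i j k

theorem PosDef.blockDiagonal'_submatrix {S : Matrix (Σ i, m i) (Σ i, m i) ℝ} (hS : S.PosDef) :
    (blockDiagonal' fun i => S.submatrix (Sigma.mk i) (Sigma.mk i)).PosDef := by
  have hadamard_eq : (blockDiagonal' fun i => S.submatrix (Sigma.mk i) (Sigma.mk i)) =
      S ⊙ (1 : Matrix o o ℝ).submatrix Sigma.fst Sigma.fst := by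
    ext ⟨i, j⟩ ⟨k, l⟩
    by_cases h : i = k
    · subst h
      simp [blockDiagonal'_apply_eq]
    · simp [blockDiagonal'_apply_ne _ _ _ h, h]
  have hpsd : (blockDiagonal' fun i => S.submatrix (Sigma.mk i) (Sigma.mk i)).PosSemidef := by
    rw [hadamard_eq]
    exact hS.posSemidef.hadamard (PosSemidef.one.submatrix _)
  rw [hpsd.posDef_iff_det_ne_zero, det_blockDiagonal']
  exact Finset.prod_ne_zero_iff.2 fun i _ => (hS.submatrix sigma_mk_injective).det_pos.ne'

/-- **Fischer's inequality** for an arbitrary partition into blocks, with its equality case. -/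
theorem PosDef.det_le_prod_det_submatrix {S : Matrix (Σ i, m i) (Σ i, m i) ℝ} (hS : S.PosDef) :
    S.det ≤ ∏ i, (S.submatrix (Sigma.mk i) (Sigma.mk i)).det ∧
      (S.det = ∏ i, (S.submatrix (Sigma.mk i) (Sigma.mk i)).det →
        S = blockDiagonal' fun i => S.submatrix (Sigma.mk i) (Sigma.mk i)) := by
  have hunit (i : o) : IsUnit (S.submatrix (Sigma.mk i) (Sigma.mk i)).det :=
    (hS.submatrix sigma_mk_injective).det_pos.ne'.isUnit
  have hinv : (blockDiagonal' fun i => S.submatrix (Sigma.mk i) (Sigma.mk i))⁻¹ =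
      blockDiagonal' fun i => (S.submatrix (Sigma.mk i) (Sigma.mk i))⁻¹ := by
    refine inv_eq_left_inv ?_
    rw [← blockDiagonal'_mul, ← blockDiagonal'_one]
    congr 1
    funext i
    exact nonsing_inv_mul _ (hunit i)
  rw [← det_blockDiagonal']
  refine hS.det_le_det_of_trace_inv_mul hS.blockDiagonal'_submatrix ?_
  rw [hinv, trace_blockDiagonal'_mul]
  simp [nonsing_inv_mul _ (hunit _)]

end BlockDiagonal

end Matrix

/-- Block Hadamard–Fischer inequality: `∏ₙ det Σₙₙ ≥ det Σ`, with equality iff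
all off-diagonal blocks of `Σ` vanish. Equivalently, the multiinformation
`I = ½ ln(∏ₙ det Σₙₙ / det Σ)` is nonnegative and vanishes iff `Σ` is block
diagonal (i.e. the Gaussian subvectors are mutually independent). -/
theorem multiinformation_nonneg {N : ℕ} (hN : 2 ≤ N) (d : Fin N → ℕ)
    (S : Matrix (blockIdx d) (blockIdx d) ℝ) (hS : S.PosDef) :
    S.det ≤ ∏ n : Fin N, (blockOf d S n n).det ∧
    ((∏ n : Fin N, (blockOf d S n n).det) = S.det ↔
      ∀ m n : Fin N, m ≠ n → blockOf d S m n = 0) := by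
  obtain ⟨hle, heq⟩ := hS.det_le_prod_det_submatrix
  refine ⟨hle, fun h m n hmn => ?_, fun h => ?_⟩
  · ext i j
    change S ⟨m, i⟩ ⟨n, j⟩ = 0
    rw [heq h.symm, blockDiagonal'_apply_ne _ _ _ hmn]
  · have hS_eq : S = blockDiagonal' fun n => blockOf d S n n := by
      ext ⟨m, i⟩ ⟨n, j⟩
      by_cases hmn : m = n
      · subst hmn
        rw [blockDiagonal'_apply_eq]
        rfl
      · rw [blockDiagonal'_apply_ne _ _ _ hmn]
        exact congrFun (congrFun (h m n hmn) i) j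
    rw [← det_blockDiagonal', ← hS_eq]
end
end

section
/- Let Σ be a symmetric positive definite d×d real matrix partitioned into N×N blocks and Γ = Σ·D⁻¹ − I_d. Then tr(Γ²) ≥ 0, and tr(Γ²) = 0 if and only if all off-diagonal blocks of Σ vanish (Σ_{mn} = 0 for all m ≠ n). (Thus the variance of the multiinformation density is zero exactly when the Gaussian subvectors are mutually independent.) -/
open MeasureTheory Matrix Real

noncomputable section

/-- The quadratic form of the block-diagonal part is the sum of the quadratic forms of `S`
at the block components of the vector. -/
lemma dotProduct_blockDiagPart_mulVec {N : ℕ} (d : Fin N → ℕ)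
    (S : Matrix (blockIdx d) (blockIdx d) ℝ) (x : blockIdx d → ℝ) :
    x ⬝ᵥ blockDiagPart d S *ᵥ x =
      ∑ m : Fin N, (fun i : blockIdx d => if i.1 = m then x i else 0) ⬝ᵥ
        S *ᵥ fun i : blockIdx d => if i.1 = m then x i else 0 := by
  simp only [dotProduct, mulVec, Finset.mul_sum, blockDiagPart, of_apply]
  refine Eq.trans ?_ Finset.sum_comm
  refine Finset.sum_congr rfl fun i _ => ?_
  refine Eq.trans ?_ Finset.sum_comm
  refine Finset.sum_congr rfl fun j _ => ?_
  rw [Finset.sum_eq_single i.1 (fun m _ hm => by simp [hm.symm]) (by simp)]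
  by_cases h : i.1 = j.1 <;> simp [h, eq_comm]

lemma Matrix.PosDef.blockDiagPart {N : ℕ} {d : Fin N → ℕ}
    {S : Matrix (blockIdx d) (blockIdx d) ℝ} (hS : S.PosDef) :
    (blockDiagPart d S).PosDef := by
  refine .of_dotProduct_mulVec_pos (IsHermitian.ext fun i j => ?_) fun x hx => ?_
  · have h : S j i = S i j := hS.isHermitian.apply i j
    simp [_root_.blockDiagPart, h, eq_comm (a := j.1)]
  · rw [star_trivial, dotProduct_blockDiagPart_mulVec]
    obtain ⟨i, hi⟩ := Function.ne_iff.mp hx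
    refine Finset.sum_pos' (fun m _ => ?_) ⟨i.1, Finset.mem_univ _, ?_⟩
    · simpa using hS.posSemidef.dotProduct_mulVec_nonneg
        (fun k : blockIdx d => if k.1 = m then x k else 0)
    · have hne : (fun k : blockIdx d => if k.1 = i.1 then x k else 0) ≠ 0 :=
        Function.ne_iff.mpr ⟨i, by simpa using hi⟩
      simpa using hS.dotProduct_mulVec_pos hne

open scoped MatrixOrder in
/-- For `E` Hermitian and `P` positive definite, `tr ((E P)²)` is nonnegative and vanishes only
for `E = 0`. -/
lemma Matrix.PosDef.trace_mul_sq {ι : Type*} [Fintype ι] [DecidableEq ι] {E P : Matrix ι ι ℝ}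
    (hP : P.PosDef) (hE : E.IsHermitian) :
    0 ≤ ((E * P) ^ 2).trace ∧ (((E * P) ^ 2).trace = 0 ↔ E = 0) := by
  obtain ⟨B, rfl⟩ := CStarAlgebra.nonneg_iff_eq_star_mul_self.mp hP.posSemidef.nonneg
  rw [star_eq_conjTranspose] at hP ⊢
  have hB : IsUnit B := isUnit_of_mul_isUnit_right hP.isUnit
  have hB' : IsUnit Bᴴ := isUnit_of_mul_isUnit_left hP.isUnit
  have hM : (B * E * Bᴴ)ᴴ = B * E * Bᴴ := by
    simp only [conjTranspose_mul, conjTranspose_conjTranspose, hE.eq, Matrix.mul_assoc]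
  have key : ((E * (Bᴴ * B)) ^ 2).trace = ((B * E * Bᴴ)ᴴ * (B * E * Bᴴ)).trace := by
    rw [hM, sq, ← Matrix.mul_assoc E, ← Matrix.mul_assoc, trace_mul_comm]
    simp only [Matrix.mul_assoc]
  rw [key, trace_conjTranspose_mul_self_eq_zero_iff, hB'.mul_left_eq_zero, hB.mul_right_eq_zero]
  exact ⟨(posSemidef_conjTranspose_mul_self _).trace_nonneg, Iff.rfl⟩

lemma sub_blockDiagPart_eq_zero_iff {N : ℕ} {d : Fin N → ℕ}
    {S : Matrix (blockIdx d) (blockIdx d) ℝ} :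
    S - blockDiagPart d S = 0 ↔ ∀ m n : Fin N, m ≠ n → blockOf d S m n = 0 := by
  refine ⟨fun h m n hmn => ?_, fun h => ?_⟩
  · ext i j
    simpa [blockDiagPart, blockOf, hmn] using congrFun₂ h ⟨m, i⟩ ⟨n, j⟩
  · ext ⟨m, i⟩ ⟨n, j⟩
    by_cases hmn : m = n
    · simp [blockDiagPart, hmn]
    · simpa [blockDiagPart, blockOf, hmn] using congrFun₂ (h m n hmn) i j

/-- `tr(Γ²) ≥ 0`, with `tr(Γ²) = 0` iff all off-diagonal blocks of `Σ` vanish,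
where `Γ = Σ·D⁻¹ − I`: the variance of the multiinformation density is zero
exactly when the Gaussian subvectors are mutually independent. -/
theorem trace_gamma_sq_nonneg {N : ℕ} (hN : 2 ≤ N) (d : Fin N → ℕ)
    (S : Matrix (blockIdx d) (blockIdx d) ℝ) (hS : S.PosDef) :
    0 ≤ (((S * (blockDiagPart d S)⁻¹ - 1) ^ 2).trace) ∧
    ((((S * (blockDiagPart d S)⁻¹ - 1) ^ 2).trace) = 0 ↔
      ∀ m n : Fin N, m ≠ n → blockOf d S m n = 0) := by
  have hD := hS.blockDiagPart
  have hΓ : S * (blockDiagPart d S)⁻¹ - 1 =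
      (S - blockDiagPart d S) * (blockDiagPart d S)⁻¹ := by
    rw [Matrix.sub_mul, mul_nonsing_inv _ ((isUnit_iff_isUnit_det _).mp hD.isUnit)]
  rw [hΓ, ← sub_blockDiagPart_eq_zero_iff]
  exact hD.inv.trace_mul_sq (hS.isHermitian.sub hD.isHermitian)
end
end

section
/- Fix ρ ∈ (0,1) and an integer l ≥ 3. For d ≥ 2, define κ_{l,d} = ((l−1)!/2) · ρ^l · ( (−1)^l·(d−1) + (d−1)^l ) and v_d = ρ²·d·(d−1)/2 (the l-th cumulant and the variance of the multiinformation density in the homogeneous correlation model). Then κ_{l,d} / v_d^{l/2} tends to 2^{l/2 − 1}·(l−1)! as d → ∞. In particular, since this limit is nonzero, the standardized multiinformation density u = (i_d − E(i_d))/√Var(i_d) is not asymptotically normal (its higher standardized cumulants do not tend to 0). -/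
open Filter Real

noncomputable section

/-- The standardized cumulant as a function of `(d - 1)⁻¹`. -/
theorem standardized_cumulant_eq {ρ x : ℝ} (hρ : 0 < ρ) (hx : 1 < x) (c : ℝ) {l : ℕ} (hl : l ≠ 0) :
    (c / 2 * ρ ^ l * ((-1 : ℝ) ^ l * (x - 1) + (x - 1) ^ l)) /
        (ρ ^ 2 * x * (x - 1) / 2) ^ ((l : ℝ) / 2) =
      c / 2 * ((-1 : ℝ) ^ l * (x - 1)⁻¹ ^ (l - 1) + 1) /
        ((1 + (x - 1)⁻¹) / 2) ^ ((l : ℝ) / 2) := by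
  obtain ⟨y, rfl⟩ : ∃ y, x = y + 1 := ⟨x - 1, by ring⟩
  obtain ⟨k, rfl⟩ := Nat.exists_eq_succ_of_ne_zero hl
  have hy : 0 < y := by linarith
  have hvar : ρ ^ 2 * (y + 1) * y / 2 = (ρ * y) ^ 2 * ((1 + y⁻¹) / 2) := by
    field_simp
  have hpow : ((ρ * y) ^ 2) ^ (((k + 1 : ℕ) : ℝ) / 2) = (ρ * y) ^ (k + 1) := by
    rw [← Real.rpow_natCast (ρ * y) 2, ← Real.rpow_mul (by positivity),
      ← Real.rpow_natCast (ρ * y) (k + 1)]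
    congr 1
    push_cast
    ring
  have hpos : 0 < ((1 + y⁻¹) / 2) ^ (((k + 1 : ℕ) : ℝ) / 2) := by positivity
  simp only [add_sub_cancel_right, Nat.succ_eq_add_one, Nat.add_sub_cancel]
  rw [hvar, Real.mul_rpow (by positivity) (by positivity), hpow]
  generalize ((1 + y⁻¹) / 2) ^ (((k + 1 : ℕ) : ℝ) / 2) = A at hpos
  rw [inv_pow]
  field_simp
  ring

/-- In the homogeneous correlation model with `ρ ∈ (0,1)`, for a fixed order
`l ≥ 3`, the standardized cumulant `κ_{l,d} / v_d^{l/2}` — where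
`κ_{l,d} = ((l−1)!/2)·ρˡ·((−1)ˡ(d−1) + (d−1)ˡ)` is the `l`-th cumulant of the
multiinformation density and `v_d = ρ²·d·(d−1)/2` its variance — tends to
`2^{l/2−1}·(l−1)!` as `d → ∞`. Since this limit is nonzero, the standardized
multiinformation density is not asymptotically normal. -/
theorem standardized_cumulant_limit (ρ : ℝ) (hρ : ρ ∈ Set.Ioo (0 : ℝ) 1)
    (l : ℕ) (hl : 3 ≤ l) :
    Filter.Tendsto
      (fun d : ℕ =>
        (((l - 1).factorial : ℝ) / 2 * ρ ^ l *
            ((-1 : ℝ) ^ l * ((d : ℝ) - 1) + ((d : ℝ) - 1) ^ l)) /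
          (ρ ^ 2 * (d : ℝ) * ((d : ℝ) - 1) / 2) ^ ((l : ℝ) / 2))
      Filter.atTop
      (nhds ((2 : ℝ) ^ ((l : ℝ) / 2 - 1) * ((l - 1).factorial : ℝ))) := by
  have hinv : Tendsto (fun d : ℕ => ((d : ℝ) - 1)⁻¹) atTop (nhds 0) :=
    tendsto_inv_atTop_zero.comp
      (tendsto_atTop_add_const_right _ (-1 : ℝ) tendsto_natCast_atTop_atTop)
  have hbase : Tendsto (fun d : ℕ => ((1 + ((d : ℝ) - 1)⁻¹) / 2) ^ ((l : ℝ) / 2)) atTop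
      (nhds (((1 + 0) / 2 : ℝ) ^ ((l : ℝ) / 2))) :=
    ((hinv.const_add 1).div_const 2).rpow_const (Or.inl (by norm_num))
  have hlim := ((((hinv.pow (l - 1)).const_mul ((-1 : ℝ) ^ l)).add_const 1).const_mul
    (((l - 1).factorial : ℝ) / 2)).div hbase (by positivity)
  have hvalue : ((l - 1).factorial : ℝ) / 2 * ((-1 : ℝ) ^ l * 0 ^ (l - 1) + 1) /
      ((1 + 0) / 2 : ℝ) ^ ((l : ℝ) / 2) =
      (2 : ℝ) ^ ((l : ℝ) / 2 - 1) * ((l - 1).factorial : ℝ) := by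
    rw [zero_pow (by omega), Real.rpow_sub two_pos, Real.rpow_one, add_zero, one_div,
      Real.inv_rpow two_pos.le]
    field_simp
    ring
  rw [hvalue] at hlim
  refine hlim.congr' ?_
  filter_upwards [eventually_gt_atTop 1] with d hd
  exact (standardized_cumulant_eq hρ.1 (by exact_mod_cast hd) _ (by omega)).symm
end
end
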